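/- arXiv:2605.02838 — 3 statements merged into one kernel-verified Lean document; each statement's English description precedes it below -/
import Mathlib

section
/- Let ε ∈ (0,1) and let Y₀ ∈ ℝ^{n×p} satisfy ‖Y₀ᵀY₀ − I_p‖_F ≤ ε. Define the sequence Y_{k+1} := Y_k((3/2)I_p − (1/2)Y_kᵀY_k) (order-1 Newton–Schulz iteration). Then for every k ≥ 0, ‖Y_kᵀY_k − I_p‖_F ≤ ‖Y₀ᵀY₀ − I_p‖_F^{2^k} ≤ ε^{2^k}. -/
open Matrix BigOperators

noncomputable section

/-- Frobenius norm of a real matrix. -/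
def frob {m k : ℕ} (A : Matrix (Fin m) (Fin k) ℝ) : ℝ :=
  Real.sqrt (∑ i, ∑ j, (A i j) ^ 2)

section Frobenius

attribute [local instance] Matrix.frobeniusNormedAddCommGroup Matrix.frobeniusNormedSpace

theorem frob_eq_norm {m k : ℕ} (A : Matrix (Fin m) (Fin k) ℝ) : frob A = ‖A‖ := by
  rw [Matrix.frobenius_norm_def, frob, Real.sqrt_eq_rpow]
  simp

theorem frob_nonneg {m k : ℕ} (A : Matrix (Fin m) (Fin k) ℝ) : 0 ≤ frob A :=
  Real.sqrt_nonneg _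

theorem frob_add_le {m k : ℕ} (A B : Matrix (Fin m) (Fin k) ℝ) :
    frob (A + B) ≤ frob A + frob B := by
  simpa only [frob_eq_norm] using norm_add_le A B

theorem frob_smul {m k : ℕ} (c : ℝ) (A : Matrix (Fin m) (Fin k) ℝ) :
    frob (c • A) = |c| * frob A := by
  simpa only [frob_eq_norm, Real.norm_eq_abs] using norm_smul c A

theorem frob_mul_le {l m k : ℕ} (A : Matrix (Fin l) (Fin m) ℝ) (B : Matrix (Fin m) (Fin k) ℝ) :
    frob (A * B) ≤ frob A * frob B := by
  simpa only [frob_eq_norm] using Matrix.frobenius_norm_mul A B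

end Frobenius

/-- The infeasibility `E = YᵀY - I` becomes `-(3/4) E² + (1/4) E³` after one iteration. -/
theorem newton_schulz_infeasibility {n p : ℕ} (Y : Matrix (Fin n) (Fin p) ℝ) :
    (Y * ((3 / 2 : ℝ) • (1 : Matrix (Fin p) (Fin p) ℝ) - (1 / 2 : ℝ) • (Yᵀ * Y)))ᵀ *
        (Y * ((3 / 2 : ℝ) • (1 : Matrix (Fin p) (Fin p) ℝ) - (1 / 2 : ℝ) • (Yᵀ * Y))) - 1 =
      (-(3 / 4) : ℝ) • ((Yᵀ * Y - 1) * (Yᵀ * Y - 1)) +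
        (1 / 4 : ℝ) • ((Yᵀ * Y - 1) * (Yᵀ * Y - 1) * (Yᵀ * Y - 1)) := by
  obtain ⟨S, hS⟩ : ∃ S, S = Yᵀ * Y := ⟨_, rfl⟩
  have hSt : Sᵀ = S := by simp [hS]
  rw [Matrix.transpose_mul, Matrix.mul_assoc, ← Matrix.mul_assoc Yᵀ, ← hS]
  simp only [Matrix.transpose_sub, Matrix.transpose_smul, Matrix.transpose_one, hSt, sub_mul,
    mul_sub, smul_mul_assoc, mul_smul_comm, one_mul, mul_one, mul_assoc]
  module

/-- One iteration squares the infeasibility bound as long as it is at most one. -/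
theorem frob_newton_schulz_le_sq {n p : ℕ} (Y : Matrix (Fin n) (Fin p) ℝ)
    (hY : frob (Yᵀ * Y - 1) ≤ 1) :
    frob ((Y * ((3 / 2 : ℝ) • (1 : Matrix (Fin p) (Fin p) ℝ) - (1 / 2 : ℝ) • (Yᵀ * Y)))ᵀ *
        (Y * ((3 / 2 : ℝ) • (1 : Matrix (Fin p) (Fin p) ℝ) - (1 / 2 : ℝ) • (Yᵀ * Y))) - 1) ≤
      frob (Yᵀ * Y - 1) ^ 2 := by
  rw [newton_schulz_infeasibility]
  generalize Yᵀ * Y - 1 = E at *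
  have hsq : frob (E * E) ≤ frob E ^ 2 := (frob_mul_le E E).trans_eq (sq _).symm
  have hcube : frob (E * E * E) ≤ frob E ^ 2 :=
    calc frob (E * E * E) ≤ frob (E * E) * frob E := frob_mul_le _ _
      _ ≤ frob (E * E) := mul_le_of_le_one_right (frob_nonneg _) hY
      _ ≤ frob E ^ 2 := hsq
  refine (frob_add_le _ _).trans ?_
  rw [frob_smul, frob_smul, abs_neg, abs_of_pos (by norm_num), abs_of_pos (by norm_num)]
  linarith

/-- Quadratic decay of the infeasibility along the order-1 Newton–Schulz iteration,
starting in the safe region `St(p,n)^ε`. -/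
theorem newton_schulz_order_one_decay {n p : ℕ} (ε : ℝ) (hε : ε ∈ Set.Ioo (0 : ℝ) 1)
    (Y : ℕ → Matrix (Fin n) (Fin p) ℝ)
    (h0 : frob ((Y 0)ᵀ * Y 0 - 1) ≤ ε)
    (hrec : ∀ k, Y (k + 1) =
      Y k * ((3 / 2 : ℝ) • (1 : Matrix (Fin p) (Fin p) ℝ) - (1 / 2 : ℝ) • ((Y k)ᵀ * Y k))) :
    ∀ k, frob ((Y k)ᵀ * Y k - 1) ≤ (frob ((Y 0)ᵀ * Y 0 - 1)) ^ (2 ^ k)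
      ∧ (frob ((Y 0)ᵀ * Y 0 - 1)) ^ (2 ^ k) ≤ ε ^ (2 ^ k) := by
  have h_nonneg := frob_nonneg ((Y 0)ᵀ * Y 0 - 1)
  have h_le_one : frob ((Y 0)ᵀ * Y 0 - 1) ≤ 1 := h0.trans hε.2.le
  intro k
  refine ⟨?_, pow_le_pow_left₀ h_nonneg h0 _⟩
  induction k with
  | zero => simp
  | succ k ih =>
    rw [hrec k, pow_succ 2 k, pow_mul]
    exact (frob_newton_schulz_le_sq (Y k) (ih.trans (pow_le_one₀ h_nonneg h_le_one))).trans
      (pow_le_pow_left₀ (frob_nonneg _) ih 2)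
end
end

section
/- Let ε ∈ (0,1), λ > 0, δ₀ > 0, and let f : ℝ^{n×p} → ℝ be twice continuously differentiable with Frobenius gradient ∇f and Hessian ∇²f. Suppose X⋆ ∈ ℝ^{n×p} satisfies X⋆ᵀX⋆ = I_p and skew(∇f(X⋆)X⋆ᵀ) = 0, that ‖∇f(X⋆)‖_F ≤ L₀, and that ‖∇f(Z) − ∇f(W)‖_F ≤ L₁‖Z − W‖_F for all Z, W ∈ St(p,n)^ε. Define J(X)[V] := 2·skew(∇²f(X)[V]·Xᵀ + ∇f(X)·Vᵀ)X + 2·skew(∇f(X)Xᵀ)V + λ·V(XᵀX − I_p) + 2λ·X·sym(XᵀV) and A(X)[V] := 2·skew(∇²f(X)[V]·Xᵀ + ∇f(X)·Vᵀ)X + 2λ·X(XᵀX)⁻¹·sym(XᵀV). Then for every X ∈ B_{δ₀}(X⋆) ∩ St(p,n)^ε and every V ∈ ℝ^{n×p}, ‖A(X)[V] − J(X)[V]‖_F ≤ L_Δ·‖X − X⋆‖_F·‖V‖_F, where L_Δ := 2(√(1+ε)L₁ + L₀) + 2λ√(1+ε)·(3+ε)/(1−ε). -/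
open Matrix BigOperators

attribute [local instance] Matrix.frobeniusNormedAddCommGroup Matrix.frobeniusNormedSpace

noncomputable section

/-- Symmetric part of a square matrix. -/
def symPart {m : ℕ} (A : Matrix (Fin m) (Fin m) ℝ) : Matrix (Fin m) (Fin m) ℝ :=
  (1 / 2 : ℝ) • (A + Aᵀ)

/-- Skew-symmetric part of a square matrix. -/
def skewPart {m : ℕ} (A : Matrix (Fin m) (Fin m) ℝ) : Matrix (Fin m) (Fin m) ℝ :=
  (1 / 2 : ℝ) • (A - Aᵀ)

section FrobeniusEstimates

variable {m n p q : ℕ}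

theorem frobenius_norm_sq_eq_trace (A : Matrix (Fin n) (Fin q) ℝ) :
    ‖A‖ ^ 2 = trace (Aᵀ * A) := by
  have h : 0 ≤ ∑ i, ∑ j, ‖A i j‖ ^ (2 : ℝ) := by positivity
  rw [frobenius_norm_def, ← Real.sqrt_eq_rpow, Real.sq_sqrt h, Finset.sum_comm]
  simp [trace, mul_apply, sq]

theorem trace_transpose_mul_le (A B : Matrix (Fin n) (Fin q) ℝ) :
    trace (Aᵀ * B) ≤ ‖A‖ * ‖B‖ := by
  have trace_eq : ∀ C D : Matrix (Fin n) (Fin q) ℝ,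
      trace (Cᵀ * D) = ∑ x : Fin q × Fin n, C x.2 x.1 * D x.2 x.1 := fun C D => by
    simp [trace, mul_apply, Fintype.sum_prod_type]
  have cauchy_schwarz := Finset.sum_mul_sq_le_sq_mul_sq Finset.univ
    (fun x : Fin q × Fin n => A x.2 x.1) (fun x => B x.2 x.1)
  refine abs_le_of_sq_le_sq' ?_ (by positivity) |>.2
  rw [mul_pow, frobenius_norm_sq_eq_trace, frobenius_norm_sq_eq_trace, trace_eq, trace_eq, trace_eq]
  simpa only [sq] using cauchy_schwarz

theorem norm_mul_le_sqrt_of_norm_gram_sub_one_le {ε : ℝ} {X : Matrix (Fin n) (Fin p) ℝ}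
    (hX : ‖Xᵀ * X - 1‖ ≤ ε) (B : Matrix (Fin p) (Fin q) ℝ) :
    ‖X * B‖ ≤ √(1 + ε) * ‖B‖ := by
  have hε : 0 ≤ ε := (norm_nonneg _).trans hX
  have h1 := trace_transpose_mul_le B ((Xᵀ * X - 1) * B)
  have h2 := (frobenius_norm_mul (Xᵀ * X - 1) B).trans
    (mul_le_mul_of_nonneg_right hX (norm_nonneg B))
  have h3 : ‖X * B‖ ^ 2 = ‖B‖ ^ 2 + trace (Bᵀ * ((Xᵀ * X - 1) * B)) := by
    rw [frobenius_norm_sq_eq_trace, frobenius_norm_sq_eq_trace, ← trace_add]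
    congr 1
    simp only [transpose_mul, Matrix.sub_mul, Matrix.mul_sub, Matrix.one_mul, Matrix.mul_assoc]
    abel
  refine abs_le_of_sq_le_sq' ?_ (by positivity) |>.2
  rw [mul_pow, Real.sq_sqrt (by linarith), h3]
  nlinarith [mul_le_mul_of_nonneg_left h2 (norm_nonneg B)]

theorem norm_transpose_mul_le_sqrt_of_norm_gram_sub_one_le {ε : ℝ}
    {X : Matrix (Fin n) (Fin p) ℝ} (hX : ‖Xᵀ * X - 1‖ ≤ ε) (A : Matrix (Fin n) (Fin q) ℝ) :
    ‖Xᵀ * A‖ ≤ √(1 + ε) * ‖A‖ := by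
  have h1 := trace_transpose_mul_le A (X * (Xᵀ * A))
  have h2 := norm_mul_le_sqrt_of_norm_gram_sub_one_le hX (Xᵀ * A)
  have h3 : ‖Xᵀ * A‖ ^ 2 = trace (Aᵀ * (X * (Xᵀ * A))) := by
    rw [frobenius_norm_sq_eq_trace]
    simp only [transpose_mul, transpose_transpose, Matrix.mul_assoc]
  rcases (norm_nonneg (Xᵀ * A)).eq_or_lt with h0 | h0
  · rw [← h0]; positivity
  · refine le_of_mul_le_mul_right ?_ h0
    nlinarith [mul_le_mul_of_nonneg_left h2 (norm_nonneg A)]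

theorem norm_le_div_of_norm_sub_one_le {ε : ℝ} (hε : ε < 1) {M : Matrix (Fin p) (Fin p) ℝ}
    (hM : ‖M - 1‖ ≤ ε) (C : Matrix (Fin p) (Fin q) ℝ) :
    ‖C‖ ≤ ‖M * C‖ / (1 - ε) := by
  have h1 := (frobenius_norm_mul (M - 1) C).trans
    (mul_le_mul_of_nonneg_right hM (norm_nonneg C))
  have h2 := norm_sub_le (M * C) ((M - 1) * C)
  rw [Matrix.sub_mul, Matrix.one_mul, sub_sub_cancel] at h2
  rw [Matrix.sub_mul, Matrix.one_mul] at h1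
  rw [le_div_iff₀ (by linarith)]
  linarith

theorem isUnit_det_of_norm_sub_one_lt_one {M : Matrix (Fin p) (Fin p) ℝ}
    (hM : ‖M - 1‖ < 1) : IsUnit M.det := by
  rw [isUnit_iff_ne_zero]
  intro h
  obtain ⟨v, hv, hMv⟩ := exists_mulVec_eq_zero_iff.2 h
  have h1 := norm_le_div_of_norm_sub_one_le hM le_rfl (replicateCol (Fin 1) v)
  rw [← replicateCol_mulVec, hMv, replicateCol_zero, norm_zero, zero_div, norm_le_zero_iff,
    replicateCol_eq_zero] at h1
  exact hv h1

theorem norm_symPart_le (A : Matrix (Fin m) (Fin m) ℝ) : ‖symPart A‖ ≤ ‖A‖ := by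
  have h := norm_add_le A Aᵀ
  rw [frobenius_norm_transpose] at h
  rw [symPart, norm_smul]
  norm_num
  linarith

theorem norm_skewPart_le (A : Matrix (Fin m) (Fin m) ℝ) : ‖skewPart A‖ ≤ ‖A‖ := by
  have h := norm_sub_le A Aᵀ
  rw [frobenius_norm_transpose] at h
  rw [skewPart, norm_smul]
  norm_num
  linarith

theorem skewPart_sub (A B : Matrix (Fin m) (Fin m) ℝ) :
    skewPart (A - B) = skewPart A - skewPart B := by
  simp only [skewPart, transpose_sub, ← smul_sub]
  congr 1
  abel

theorem norm_gram_sub_one_le {ε : ℝ} {X Y : Matrix (Fin n) (Fin p) ℝ}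
    (hX : ‖Xᵀ * X - 1‖ ≤ ε) (hY : Yᵀ * Y = 1) :
    ‖Xᵀ * X - 1‖ ≤ (√(1 + ε) + 1) * ‖X - Y‖ := by
  have h1 := norm_transpose_mul_le_sqrt_of_norm_gram_sub_one_le hX (X - Y)
  have h2 := norm_transpose_mul_le_sqrt_of_norm_gram_sub_one_le
    (X := Y) (ε := 0) (by simp [hY]) (X - Y)
  rw [add_zero, Real.sqrt_one, one_mul] at h2
  have h3 : Xᵀ * X - 1 = Xᵀ * (X - Y) + (Yᵀ * (X - Y))ᵀ := by
    simp only [transpose_mul, transpose_sub, transpose_transpose, transpose_one, Matrix.mul_sub,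
      hY]
    abel
  have h4 := norm_add_le (Xᵀ * (X - Y)) (Yᵀ * (X - Y))ᵀ
  rw [frobenius_norm_transpose] at h4
  rw [h3]
  linarith

end FrobeniusEstimates

/-- The discrepancy between the second-order landing operator `A(X)` and the Jacobian
`J(X)` of the landing field vanishes linearly with the distance to the stationary point:
`‖A(X)[V] − J(X)[V]‖_F ≤ L_Δ ‖X − X⋆‖_F ‖V‖_F`, with
`L_Δ = 2(√(1+ε)L₁ + L₀) + 2λ√(1+ε)(3+ε)/(1−ε)`. Matrices carry the Frobenius norm. -/
theorem approx_jacobian_discrepancy {n p : ℕ}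
    (ε lam δ₀ L₀ L₁ : ℝ)
    (hε : ε ∈ Set.Ioo (0 : ℝ) 1) (hlam : 0 < lam) (hδ₀ : 0 < δ₀)
    (f : Matrix (Fin n) (Fin p) ℝ → ℝ)
    (Gf : Matrix (Fin n) (Fin p) ℝ → Matrix (Fin n) (Fin p) ℝ)
    (Hf : Matrix (Fin n) (Fin p) ℝ → Matrix (Fin n) (Fin p) ℝ →L[ℝ] Matrix (Fin n) (Fin p) ℝ)
    (hf : ContDiff ℝ 2 f)
    (hG : ∀ X V, fderiv ℝ f X V = Matrix.trace ((Gf X)ᵀ * V))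
    (hH : ∀ X, HasFDerivAt Gf (Hf X) X)
    (Xs : Matrix (Fin n) (Fin p) ℝ)
    (hXs : Xsᵀ * Xs = 1)
    (hstat : skewPart (Gf Xs * Xsᵀ) = 0)
    (hL0 : ‖Gf Xs‖ ≤ L₀)
    (hL1 : ∀ Z W : Matrix (Fin n) (Fin p) ℝ, ‖Zᵀ * Z - 1‖ ≤ ε → ‖Wᵀ * W - 1‖ ≤ ε →
      ‖Gf Z - Gf W‖ ≤ L₁ * ‖Z - W‖)
    (J A : Matrix (Fin n) (Fin p) ℝ → Matrix (Fin n) (Fin p) ℝ → Matrix (Fin n) (Fin p) ℝ)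
    (hJ : ∀ X V, J X V =
      (2 : ℝ) • skewPart (Hf X V * Xᵀ + Gf X * Vᵀ) * X
      + (2 : ℝ) • skewPart (Gf X * Xᵀ) * V
      + lam • (V * (Xᵀ * X - 1))
      + (2 * lam) • (X * symPart (Xᵀ * V)))
    (hA : ∀ X V, A X V =
      (2 : ℝ) • skewPart (Hf X V * Xᵀ + Gf X * Vᵀ) * X
      + (2 * lam) • (X * (Xᵀ * X)⁻¹ * symPart (Xᵀ * V))) :
    ∀ X : Matrix (Fin n) (Fin p) ℝ, ‖X - Xs‖ < δ₀ → ‖Xᵀ * X - 1‖ ≤ ε →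
      ∀ V, ‖A X V - J X V‖ ≤
        (2 * (Real.sqrt (1 + ε) * L₁ + L₀)
          + 2 * lam * Real.sqrt (1 + ε) * (3 + ε) / (1 - ε)) * ‖X - Xs‖ * ‖V‖ := by
  obtain ⟨hε0, hε1⟩ := hε
  intro X _ hX V
  set D := ‖X - Xs‖
  set s := √(1 + ε)
  have hs1 : 1 ≤ s := Real.one_le_sqrt.2 (by linarith)
  have hs2 : s ^ 2 = 1 + ε := Real.sq_sqrt (by linarith)
  have hD : 0 ≤ D := norm_nonneg _
  have hgram : ‖Xᵀ * X - 1‖ ≤ (s + 1) * D := norm_gram_sub_one_le hX hXs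
  have hdet : IsUnit (Xᵀ * X).det := isUnit_det_of_norm_sub_one_lt_one (hX.trans_lt hε1)
  have hskew : ‖skewPart (Gf X * Xᵀ)‖ ≤ (s * L₁ + L₀) * D := by
    have hsplit : Gf X * Xᵀ - Gf Xs * Xsᵀ = (Gf X - Gf Xs) * Xᵀ + Gf Xs * (X - Xs)ᵀ := by
      rw [Matrix.sub_mul, transpose_sub, Matrix.mul_sub]
      abel
    have h1 : ‖(Gf X - Gf Xs) * Xᵀ‖ ≤ s * (L₁ * D) := by
      rw [← frobenius_norm_transpose, transpose_mul, transpose_transpose]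
      refine (norm_mul_le_sqrt_of_norm_gram_sub_one_le hX _).trans ?_
      rw [frobenius_norm_transpose]
      exact mul_le_mul_of_nonneg_left (hL1 X Xs hX (by simp [hXs, hε0.le])) (by positivity)
    have h2 : ‖Gf Xs * (X - Xs)ᵀ‖ ≤ L₀ * D := by
      refine (frobenius_norm_mul _ _).trans ?_
      rw [frobenius_norm_transpose]
      exact mul_le_mul_of_nonneg_right hL0 hD
    calc ‖skewPart (Gf X * Xᵀ)‖ = ‖skewPart (Gf X * Xᵀ - Gf Xs * Xsᵀ)‖ := by
          rw [skewPart_sub, hstat, sub_zero]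
      _ ≤ ‖(Gf X - Gf Xs) * Xᵀ + Gf Xs * (X - Xs)ᵀ‖ := hsplit ▸ norm_skewPart_le _
      _ ≤ (s * L₁ + L₀) * D := by linarith [norm_add_le ((Gf X - Gf Xs) * Xᵀ) (Gf Xs * (X - Xs)ᵀ)]
  set S := symPart (Xᵀ * V)
  have hS : ‖S‖ ≤ s * ‖V‖ := (norm_symPart_le _).trans
    (norm_transpose_mul_le_sqrt_of_norm_gram_sub_one_le hX V)
  have hinv : ‖X * ((Xᵀ * X)⁻¹ * S - S)‖ ≤ s * ((s + 1) * D * (s * ‖V‖) / (1 - ε)) := by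
    refine (norm_mul_le_sqrt_of_norm_gram_sub_one_le hX _).trans
      (mul_le_mul_of_nonneg_left ?_ (by positivity))
    refine (norm_le_div_of_norm_sub_one_le hε1 hX _).trans
      (div_le_div_of_nonneg_right ?_ (by linarith))
    have h1 : Xᵀ * X * ((Xᵀ * X)⁻¹ * S - S) = -((Xᵀ * X - 1) * S) := by
      rw [Matrix.mul_sub, mul_nonsing_inv_cancel_left _ _ hdet, Matrix.sub_mul, Matrix.one_mul]
      abel
    rw [h1, norm_neg]
    exact (frobenius_norm_mul _ _).trans
      (mul_le_mul hgram hS (norm_nonneg _) (by positivity))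
  have hdiff : A X V - J X V = (2 * lam) • (X * ((Xᵀ * X)⁻¹ * S - S))
      - (2 : ℝ) • (skewPart (Gf X * Xᵀ) * V) - lam • (V * (Xᵀ * X - 1)) := by
    simp only [hA, hJ, S, Matrix.mul_sub X, smul_sub (2 * lam), Matrix.mul_assoc X, Matrix.smul_mul]
    abel
  have hskewV : ‖skewPart (Gf X * Xᵀ) * V‖ ≤ (s * L₁ + L₀) * D * ‖V‖ :=
    (frobenius_norm_mul _ _).trans (mul_le_mul_of_nonneg_right hskew (norm_nonneg V))
  have hgramV : ‖V * (Xᵀ * X - 1)‖ ≤ ‖V‖ * ((s + 1) * D) :=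
    (frobenius_norm_mul _ _).trans (mul_le_mul_of_nonneg_left hgram (norm_nonneg V))
  have hconst : 2 * (s * ((s + 1) * s / (1 - ε))) + (s + 1) ≤ 2 * s * (3 + ε) / (1 - ε) := by
    have h1 : 0 < 1 - ε := by linarith
    have h2 : 2 * (s * ((s + 1) * s / (1 - ε))) + (s + 1) = (s + 1) * (3 + ε) / (1 - ε) := by
      field_simp
      linear_combination 2 * hs2
    rw [h2]
    gcongr
    linarith
  calc ‖A X V - J X V‖
      ≤ 2 * lam * ‖X * ((Xᵀ * X)⁻¹ * S - S)‖ + 2 * ‖skewPart (Gf X * Xᵀ) * V‖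
        + lam * ‖V * (Xᵀ * X - 1)‖ := by
        rw [hdiff]
        refine (norm_sub_le _ _).trans (add_le_add ((norm_sub_le _ _).trans (le_of_eq ?_)) ?_)
        · rw [norm_smul, norm_smul, Real.norm_of_nonneg (by positivity : 0 ≤ 2 * lam),
            Real.norm_of_nonneg (zero_le_two : (0 : ℝ) ≤ 2)]
        · rw [norm_smul, Real.norm_of_nonneg hlam.le]
    _ ≤ 2 * lam * (s * ((s + 1) * D * (s * ‖V‖) / (1 - ε))) + 2 * ((s * L₁ + L₀) * D * ‖V‖)
        + lam * (‖V‖ * ((s + 1) * D)) := by gcongr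
    _ = 2 * (s * L₁ + L₀) * D * ‖V‖
        + lam * (D * ‖V‖) * (2 * (s * ((s + 1) * s / (1 - ε))) + (s + 1)) := by ring
    _ ≤ 2 * (s * L₁ + L₀) * D * ‖V‖ + lam * (D * ‖V‖) * (2 * s * (3 + ε) / (1 - ε)) := by gcongr
    _ = (2 * (s * L₁ + L₀) + 2 * lam * s * (3 + ε) / (1 - ε)) * D * ‖V‖ := by ring
end
end

section
/- Let X ∈ ℝ^{n×p} have full column rank, let G ∈ ℝ^{n×p}, and let λ > 0. Then 2·skew(GXᵀ)X + λ·X(XᵀX − I_p) = 0 if and only if both 2·skew(GXᵀ)X = 0 and XᵀX = I_p. In particular, with G = ∇f(X), the landing field Λ₁(X) = T₁(X) + λ·X(XᵀX − I_p) vanishes if and only if T₁(X) = 0 and X ∈ St(p,n). -/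
open Matrix BigOperators

noncomputable section

lemma skewPart_transpose {m : ℕ} (A : Matrix (Fin m) (Fin m) ℝ) :
    (skewPart A)ᵀ = -skewPart A := by
  simp [skewPart, ← smul_neg]

/-- The Gram matrix of a matrix of full column rank is invertible. -/
lemma isUnit_transpose_mul_self_of_rank_eq {n p : ℕ} {X : Matrix (Fin n) (Fin p) ℝ}
    (hX : X.rank = p) : IsUnit (Xᵀ * X) := by
  rw [← Matrix.linearIndependent_rows_iff_isUnit, linearIndependent_iff_card_eq_finrank_span,
    Set.finrank, ← Matrix.rank_eq_finrank_span_row, Matrix.rank_transpose_mul_self, hX,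
    Fintype.card_fin]

/-- For full-column-rank `X`, the landing field `2 skew(GXᵀ)X + λX(XᵀX − I)` vanishes iff
both the tangent part `2 skew(GXᵀ)X` vanishes and `X` is feasible (`XᵀX = I`). -/
theorem landing_field_zero_iff {n p : ℕ}
    (X G : Matrix (Fin n) (Fin p) ℝ) (hX : X.rank = p)
    (lam : ℝ) (hlam : 0 < lam) :
    (2 : ℝ) • skewPart (G * Xᵀ) * X + lam • (X * (Xᵀ * X - 1)) = 0
      ↔ ((2 : ℝ) • skewPart (G * Xᵀ) * X = 0 ∧ Xᵀ * X = 1) := by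
  refine ⟨fun h => ?_, fun ⟨h₁, h₂⟩ => by simp [h₁, h₂]⟩
  have hW : ((2 : ℝ) • skewPart (G * Xᵀ))ᵀ = -((2 : ℝ) • skewPart (G * Xᵀ)) := by
    rw [transpose_smul, skewPart_transpose, smul_neg]
  generalize (2 : ℝ) • skewPart (G * Xᵀ) = W at h hW ⊢
  suffices hS : Xᵀ * X = 1 by simpa [hS] using h
  have h₁ : Xᵀ * W * X + lam • (Xᵀ * X * (Xᵀ * X - 1)) = 0 := by
    simpa [Matrix.mul_add, Matrix.mul_assoc] using congrArg (Xᵀ * ·) h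
  have h₂ : -(Xᵀ * W * X) + lam • (Xᵀ * X * (Xᵀ * X - 1)) = 0 := by
    have := congrArg transpose h₁
    simpa [hW, Matrix.mul_assoc, Matrix.mul_sub, Matrix.sub_mul] using this
  have h₃ : (2 * lam) • (Xᵀ * X * (Xᵀ * X - 1)) = 0 := by
    rw [two_mul, add_smul]
    calc _ = (Xᵀ * W * X + lam • (Xᵀ * X * (Xᵀ * X - 1)))
          + (-(Xᵀ * W * X) + lam • (Xᵀ * X * (Xᵀ * X - 1))) := by abel
      _ = 0 := by rw [h₁, h₂, add_zero]
  have h₄ := (smul_eq_zero.mp h₃).resolve_left (by positivity)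
  exact sub_eq_zero.mp ((isUnit_transpose_mul_self_of_rank_eq hX).mul_right_eq_zero.mp h₄)
end
end
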